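/- arXiv:2012.04482 — 4 statements merged into one kernel-verified Lean document; each statement's English description precedes it below -/
import Mathlib

section
/- Let γ, x, y be complex numbers with γ ≠ 0 and sinh(γx) ≠ 0, sinh(γy) ≠ 0, sinh(γ(x+y)) ≠ 0. Writing Φ(u) = γ/sinh(γu), Φ'(u) = −γ²·cosh(γu)/sinh²(γu), Φ''(u) = γ³·(1 + cosh²(γu))/sinh³(γu), ℘(u) = γ²/sinh²(γu), ℘'(u) = −2γ³·cosh(γu)/sinh³(γu), one has Φ(x)·Φ''(y) − Φ(y)·Φ''(x) = 2·Φ'(x+y)·(℘(x) − ℘(y)) + Φ(x+y)·(℘'(x) − ℘'(y)). (Hyperbolic degeneration of the paper's identity (A5).) -/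
/-- Hyperbolic degeneration of the paper's identity (A5):
`Φ(x)Φ''(y) − Φ(y)Φ''(x) = 2Φ'(x+y)(℘(x) − ℘(y)) + Φ(x+y)(℘'(x) − ℘'(y))`. -/
theorem stmt_1 (γ x y : ℂ) (hγ : γ ≠ 0)
    (hx : Complex.sinh (γ * x) ≠ 0) (hy : Complex.sinh (γ * y) ≠ 0)
    (hxy : Complex.sinh (γ * (x + y)) ≠ 0) :
    (γ / Complex.sinh (γ * x)) *
        (γ ^ 3 * (1 + Complex.cosh (γ * y) ^ 2) / Complex.sinh (γ * y) ^ 3)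
      - (γ / Complex.sinh (γ * y)) *
        (γ ^ 3 * (1 + Complex.cosh (γ * x) ^ 2) / Complex.sinh (γ * x) ^ 3)
      = 2 * (-γ ^ 2 * Complex.cosh (γ * (x + y)) / Complex.sinh (γ * (x + y)) ^ 2) *
          (γ ^ 2 / Complex.sinh (γ * x) ^ 2 - γ ^ 2 / Complex.sinh (γ * y) ^ 2)
        + (γ / Complex.sinh (γ * (x + y))) *
          (-2 * γ ^ 3 * Complex.cosh (γ * x) / Complex.sinh (γ * x) ^ 3
            - (-2 * γ ^ 3 * Complex.cosh (γ * y) / Complex.sinh (γ * y) ^ 3)) := by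
  have hcx := Complex.cosh_sq (γ * x)
  have hcy := Complex.cosh_sq (γ * y)
  rw [mul_add γ x y, Complex.sinh_add] at hxy
  rw [mul_add γ x y, Complex.sinh_add, Complex.cosh_add]
  generalize Complex.sinh (γ * x) = a at *
  generalize Complex.sinh (γ * y) = b at *
  generalize Complex.cosh (γ * x) = c at *
  generalize Complex.cosh (γ * y) = d at *
  generalize hs : a * d + c * b = s at *
  field_simp
  subst hs
  linear_combination
    (2 * a ^ 2 * b ^ 2 - (a * d + c * b) ^ 2 * b ^ 2) * hcx
      + ((a * d + c * b) ^ 2 * a ^ 2 - 2 * a ^ 2 * b ^ 2) * hcy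
end

section
/- Let N ∈ ℕ and let p₁,…,p_N, q₁,…,q_N, h₁,…,h_N be complex numbers. Index the rows and columns of 2N×2N complex matrices by pairs (i,ε) with 1 ≤ i ≤ N and ε ∈ {0,1}. Set x_{(i,0)} = pᵢ, x_{(i,1)} = qᵢ, y_{(i,0)} = −qᵢ, y_{(i,1)} = −pᵢ, and assume x_a − y_b ≠ 0 for all indices a,b (i.e. pᵢ + qⱼ ≠ 0, pᵢ + pⱼ ≠ 0, qᵢ + qⱼ ≠ 0 for all i,j). Let K be the Cauchy matrix K_{ab} = 1/(x_a − y_b) and let H be the diagonal matrix with H_{(i,0)} = H_{(i,1)} = hᵢ. Then for every i, the two diagonal entries of the adjugate of I + H·K at (i,0) and (i,1) coincide: adj(I + HK)_{(i,0),(i,0)} = adj(I + HK)_{(i,1),(i,1)}. (This is the paper's claim that the diagonal (2i−1,2i−1) and (2i,2i) minors of I + HK are equal for the CKP-symmetric soliton data.) -/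
namespace Matrix

variable {n R : Type*} [Fintype n] [DecidableEq n] [CommRing R]

/-- A diagonal entry of the adjugate of `1 + DK`, with `D` diagonal, is the determinant
obtained by setting the corresponding entry of `D` to zero. -/
theorem adjugate_one_add_diagonal_mul_apply_self (d : n → R) (K : Matrix n n R) (a : n) :
    (1 + diagonal d * K).adjugate a a = (1 + diagonal (Function.update d a 0) * K).det := by
  rw [adjugate_apply]
  congr 1
  ext b c
  by_cases hb : b = a
  · subst hb
    simp [diagonal_mul, one_eq_pi_single]
  · simp [updateRow_ne hb, diagonal_mul, Function.update_of_ne hb]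

/-- Transposing `K` does not change the diagonal entries of the adjugate of `1 + DK`. -/
theorem adjugate_one_add_diagonal_mul_transpose_apply_self (d : n → R) (K : Matrix n n R)
    (a : n) :
    (1 + diagonal d * Kᵀ).adjugate a a = (1 + diagonal d * K).adjugate a a := by
  rw [adjugate_one_add_diagonal_mul_apply_self, adjugate_one_add_diagonal_mul_apply_self,
    ← det_transpose, transpose_add, transpose_mul, transpose_transpose, diagonal_transpose,
    transpose_one, det_one_add_mul_comm]

/-- If a permutation `σ` of the indices transposes `K` and fixes the diagonal matrix `D`, then
the diagonal entries of the adjugate of `1 + DK` are invariant under `σ`. -/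
theorem adjugate_one_add_diagonal_mul_apply_perm (d : n → R) (K : Matrix n n R)
    (σ : Equiv.Perm n) (hd : ∀ a, d (σ a) = d a) (hK : K.submatrix σ σ = Kᵀ) (a : n) :
    (1 + diagonal d * K).adjugate (σ a) (σ a) = (1 + diagonal d * K).adjugate a a := by
  have hσ : (1 + diagonal d * K).submatrix σ σ = 1 + diagonal d * Kᵀ := by
    ext b c
    simp [← hK, diagonal_mul, hd, one_apply]
  rw [← adjugate_one_add_diagonal_mul_transpose_apply_self d K a, ← hσ,
    adjugate_submatrix_equiv_self, submatrix_apply]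

end Matrix


/-- For the CKP-symmetric soliton data, the diagonal `(i,0)` and `(i,1)`
entries of the adjugate of `I + HK` coincide. -/
theorem stmt_14 (N : ℕ) (p q h : Fin N → ℂ) :
    let x : Fin N × Fin 2 → ℂ := fun a => if a.2 = 0 then p a.1 else q a.1
    let y : Fin N × Fin 2 → ℂ := fun a => if a.2 = 0 then -q a.1 else -p a.1
    let K : Matrix (Fin N × Fin 2) (Fin N × Fin 2) ℂ :=
      Matrix.of fun a b => 1 / (x a - y b)
    let H : Matrix (Fin N × Fin 2) (Fin N × Fin 2) ℂ :=
      Matrix.diagonal fun a => h a.1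
    (∀ a b : Fin N × Fin 2, x a - y b ≠ 0) →
      ∀ i : Fin N,
        ((1 : Matrix (Fin N × Fin 2) (Fin N × Fin 2) ℂ) + H * K).adjugate (i, 0) (i, 0)
          = ((1 : Matrix (Fin N × Fin 2) (Fin N × Fin 2) ℂ) + H * K).adjugate (i, 1) (i, 1) := by
  intro x y K H _ i
  have hK : K.submatrix ((Equiv.refl (Fin N)).prodCongr (Equiv.swap 0 1))
      ((Equiv.refl (Fin N)).prodCongr (Equiv.swap 0 1)) = K.transpose := by
    ext ⟨j, ε⟩ ⟨k, δ⟩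
    fin_cases ε <;> fin_cases δ <;> simp [K, x, y, add_comm]
  simpa using (Matrix.adjugate_one_add_diagonal_mul_apply_perm
    (fun a => h a.1) K _ (fun _ => rfl) hK (i, 0)).symm
end

section
/- Let N ∈ ℕ and let p₁,…,p_N, q₁,…,q_N, h₁,…,h_N, v₁,…,v_N be complex numbers. Index 2N×2N complex matrices by pairs (i,ε), ε ∈ {0,1}; set x_{(i,0)} = pᵢ, x_{(i,1)} = qᵢ, y_{(i,0)} = −qᵢ, y_{(i,1)} = −pᵢ and assume x_a − y_b ≠ 0 for all a,b. Let K_{ab} = 1/(x_a − y_b), let H be diagonal with H_{(i,0)} = H_{(i,1)} = hᵢ, and let V be diagonal with V_{(i,0)} = vᵢ and V_{(i,1)} = −vᵢ. Then trace( adj(I + H·K) · V · H · K ) = 0. (This expresses the paper's claim that the even-time derivatives ∂_{t_{2m}} log τ^{KP} of the multi-soliton tau-function (ms3) vanish at zero even times, i.e. soliton tau-functions satisfy the CKP turning-point condition (ch6); there vᵢ = pᵢ^{2m} − qᵢ^{2m}.) -/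
namespace Matrix

section PushThrough

variable {n R : Type*} [Fintype n] [DecidableEq n] [CommRing R]

theorem adjugate_mul_eq_mul_adjugate_of_isLeftRegular_det {A B C : Matrix n n R}
    (hA : IsLeftRegular A.det) (hdet : A.det = B.det) (hAC : A * C = C * B) :
    A.adjugate * C = C * B.adjugate := by
  have key : A.det • (A.adjugate * C) = A.det • (C * B.adjugate) := by
    calc A.det • (A.adjugate * C) = A.adjugate * C * (B.det • 1) := by
          rw [hdet, Matrix.mul_smul, Matrix.mul_one]
      _ = A.adjugate * (C * B) * B.adjugate := by
          rw [← mul_adjugate]; simp only [Matrix.mul_assoc]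
      _ = A.det • (C * B.adjugate) := by
          rw [← hAC, ← Matrix.mul_assoc, adjugate_mul, smul_mul, smul_mul, Matrix.one_mul]
  ext i j
  exact hA (congrFun (congrFun key i) j)

/-- The push-through identity for adjugates. -/
theorem adjugate_one_sub_mul_mul (A B : Matrix n n R) :
    (1 - A * B).adjugate * A = A * (1 - B * A).adjugate := by
  let f : Matrix n n (Polynomial R) →+* Matrix n n R :=
    (Polynomial.evalRingHom 1).mapMatrix
  have f_map (M : Matrix n n R) : f (Polynomial.C.mapMatrix M) = M := by
    ext i j; simp [f]
  have f_charmatrix (M : Matrix n n R) : f (charmatrix M) = 1 - M := by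
    rw [charmatrix, map_sub, f_map]
    ext i j
    by_cases hij : i = j <;> simp [f, hij]
  have f_adjugate (M : Matrix n n R) : f (charmatrix M).adjugate = (1 - M).adjugate := by
    rw [← f_charmatrix, RingHom.map_adjugate]
  have key := adjugate_mul_eq_mul_adjugate_of_isLeftRegular_det
    (A := charmatrix (A * B)) (B := charmatrix (B * A)) (C := Polynomial.C.mapMatrix A)
    (charpoly_monic (A * B)).isRegular.left (charpoly_mul_comm A B) (by
      rw [charmatrix, charmatrix, sub_mul, mul_sub, map_mul, map_mul, Matrix.mul_assoc,
        (scalar_commute _ (fun r => Commute.all _ r) _).eq])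
  simpa only [map_mul, f_map, f_adjugate] using congrArg f key

theorem adjugate_one_add_mul_mul (A B : Matrix n n R) :
    (1 + A * B).adjugate * A = A * (1 + B * A).adjugate := by
  simpa using adjugate_one_sub_mul_mul A (-B)

/-- Conjugation by a permutation that transposes `K`, fixes `H` and negates `V` changes the sign
of the trace. -/
theorem trace_adjugate_one_add_mul_eq_neg (e : Equiv.Perm n) {K H V : Matrix n n R}
    (hK : K.submatrix e e = Kᵀ) (hH : H.submatrix e e = H) (hV : V.submatrix e e = -V)
    (hHt : H.IsSymm) (hVt : V.IsSymm) (hHV : Commute H V) :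
    ((1 + H * K).adjugate * (V * (H * K))).trace =
      -((1 + H * K).adjugate * (V * (H * K))).trace := by
  have hsub : ((1 + H * K).adjugate * (V * (H * K))).submatrix e e =
      -(K * H * V * (1 + K * H).adjugate)ᵀ := by
    have hHK : (H * K).submatrix e e = H * Kᵀ := by
      rw [← submatrix_mul_equiv _ _ _ e, hH, hK]
    rw [← submatrix_mul_equiv _ _ _ e, ← submatrix_mul_equiv V _ _ e,
      ← adjugate_submatrix_equiv_self,
      submatrix_add, Pi.add_apply, Pi.add_apply, submatrix_one_equiv, hHK, hV]
    simp [transpose_mul, adjugate_transpose, hHt.eq, hVt.eq]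
  calc ((1 + H * K).adjugate * (V * (H * K))).trace
      = (((1 + H * K).adjugate * (V * (H * K))).submatrix e e).trace :=
        (Equiv.sum_comp e fun i => ((1 + H * K).adjugate * (V * (H * K))) i i).symm
    _ = -(K * H * V * (1 + K * H).adjugate).trace := by
        rw [hsub, trace_neg, trace_transpose]
    _ = -((1 + K * H).adjugate * K * (H * V)).trace := by
        rw [trace_mul_comm]; simp only [Matrix.mul_assoc]
    _ = -(K * ((1 + H * K).adjugate * (V * H))).trace := by
        rw [adjugate_one_add_mul_mul, hHV.eq, Matrix.mul_assoc]
    _ = -((1 + H * K).adjugate * (V * (H * K))).trace := by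
        rw [trace_mul_comm]; simp only [Matrix.mul_assoc]

end PushThrough

end Matrix


/-- Soliton tau-functions satisfy the CKP turning-point condition (ch6):
`trace(adj(I + HK)·V·H·K) = 0` for the CKP-symmetric soliton data. -/
theorem stmt_15 (N : ℕ) (p q h v : Fin N → ℂ) :
    let x : Fin N × Fin 2 → ℂ := fun a => if a.2 = 0 then p a.1 else q a.1
    let y : Fin N × Fin 2 → ℂ := fun a => if a.2 = 0 then -q a.1 else -p a.1
    let K : Matrix (Fin N × Fin 2) (Fin N × Fin 2) ℂ :=
      Matrix.of fun a b => 1 / (x a - y b)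
    let H : Matrix (Fin N × Fin 2) (Fin N × Fin 2) ℂ :=
      Matrix.diagonal fun a => h a.1
    let V : Matrix (Fin N × Fin 2) (Fin N × Fin 2) ℂ :=
      Matrix.diagonal fun a => if a.2 = 0 then v a.1 else -v a.1
    (∀ a b : Fin N × Fin 2, x a - y b ≠ 0) →
      Matrix.trace
        (((1 : Matrix (Fin N × Fin 2) (Fin N × Fin 2) ℂ) + H * K).adjugate
          * (V * (H * K))) = 0 := by
  intro x y K H V _
  let e : Equiv.Perm (Fin N × Fin 2) := Equiv.prodCongr (Equiv.refl _) (Equiv.swap 0 1)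
  have hxy : ∀ a, x (e a) = -y a := by
    rintro ⟨i, ε⟩
    fin_cases ε <;> simp [x, y, e]
  have hyx : ∀ a, y (e a) = -x a := by
    rintro ⟨i, ε⟩
    fin_cases ε <;> simp [x, y, e]
  refine self_eq_neg.mp (Matrix.trace_adjugate_one_add_mul_eq_neg e ?_ ?_ ?_
    (Matrix.isSymm_diagonal _) (Matrix.isSymm_diagonal _) (Matrix.commute_diagonal _ _))
  · ext a b
    simp only [K, Matrix.submatrix_apply, Matrix.transpose_apply, Matrix.of_apply, hxy, hyx]
    congr 1
    ring
  · rw [Matrix.submatrix_diagonal_equiv]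
    rfl
  · rw [Matrix.submatrix_diagonal_equiv, Matrix.diagonal_neg]
    congr 1
    funext ⟨i, ε⟩
    fin_cases ε <;> simp [e]
end

section
/- Let p, q, α, z be complex numbers with p·q ≠ 0, z ≠ 0, z + p ≠ 0 and z + q ≠ 0. Set β := α²·(p−q)²/(4pq), λ₁ := (z−p)/(z+q), λ₂ := (z−q)/(z+p), and for u ∈ ℂ define T(u) := 1 + 2αu − βu² and T₁(u) := 1 + α(λ₁+λ₂)u − β·λ₁λ₂·u². Let w(x) := exp((p+q)x). Then for every x ∈ ℂ with T(w(x)) ≠ 0, the function y ↦ e^{2yz}·T(λ₁λ₂·w(y))/T(w(y)) is complex differentiable at x and its derivative equals 2z·e^{2xz}·(T₁(w(x))/T(w(x)))². (This is the identity (1/2z)·∂_x(e^{2xz}·τ^{KP}(t+[−z⁻¹]−[z⁻¹])/τ^{KP}(t)) = e^{2xz}·(τ^{KP}(t−[z⁻¹])/τ^{KP}(t))² verified for the one-soliton CKP tau-function (e2); it expresses that ∂_x ψ² is a full square for the one-soliton solution.) -/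
/-- The one-soliton CKP identity: `(1/2z)·∂ₓ(e^{2xz}·T(λ₁λ₂w)/T(w)) =
e^{2xz}·(T₁(w)/T(w))²` expressing that `∂ₓψ²` is a full square. -/
theorem stmt_16 (p q α z : ℂ) (hpq : p * q ≠ 0) (hz : z ≠ 0)
    (hzp : z + p ≠ 0) (hzq : z + q ≠ 0) :
    let β : ℂ := α ^ 2 * (p - q) ^ 2 / (4 * p * q)
    let l₁ : ℂ := (z - p) / (z + q)
    let l₂ : ℂ := (z - q) / (z + p)
    let T : ℂ → ℂ := fun u => 1 + 2 * α * u - β * u ^ 2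
    let T₁ : ℂ → ℂ := fun u => 1 + α * (l₁ + l₂) * u - β * (l₁ * l₂) * u ^ 2
    let w : ℂ → ℂ := fun x => Complex.exp ((p + q) * x)
    ∀ x : ℂ, T (w x) ≠ 0 →
      HasDerivAt (fun y => Complex.exp (2 * y * z) * T (l₁ * l₂ * w y) / T (w y))
        (2 * z * Complex.exp (2 * x * z) * (T₁ (w x) / T (w x)) ^ 2) x := by
  intro β l₁ l₂ T T₁ w x hT
  have hp : p ≠ 0 := left_ne_zero_of_mul hpq
  have hq : q ≠ 0 := right_ne_zero_of_mul hpq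
  have hw : HasDerivAt w ((p + q) * w x) x := by
    have h := (((hasDerivAt_id x).const_mul (p + q)).cexp)
    simpa [w, mul_comm] using h
  have he : HasDerivAt (fun y => Complex.exp (2 * y * z))
      (2 * z * Complex.exp (2 * x * z)) x := by
    have h := ((((hasDerivAt_id x).const_mul 2).mul_const z).cexp)
    simpa [mul_comm] using h
  have hTd (u : ℂ) : HasDerivAt T (2 * α - 2 * β * u) u := by
    have h := (((hasDerivAt_id u).const_mul (2 * α)).const_add 1).sub
      (((hasDerivAt_id u).pow 2).const_mul β)
    refine h.congr_deriv ?_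
    simp
    ring
  have key (u : ℂ) : 2 * z * T (l₁ * l₂ * u) * T u
      + (p + q) * u * (l₁ * l₂ * (2 * α - 2 * β * (l₁ * l₂ * u)) * T u
        - T (l₁ * l₂ * u) * (2 * α - 2 * β * u)) = 2 * z * T₁ u ^ 2 := by
    simp only [T, T₁, β, l₁, l₂]
    field_simp
    ring
  have hnum := he.mul ((hTd (l₁ * l₂ * w x)).comp x (hw.const_mul (l₁ * l₂)))
  refine (hnum.div ((hTd (w x)).comp x hw) hT).congr_deriv ?_
  clear_value T T₁ w l₁ l₂ β
  simp only [Function.comp_apply, Pi.mul_apply]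
  rw [div_pow, ← mul_div_assoc]
  congr 1
  linear_combination Complex.exp (2 * x * z) * key (w x)
end
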